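/- Fix an integer N ≥ 2. For n ≥ 1 define I_n = (n/(2π))^{(N−1)/2} ∫_{Δ} exp( n·H(p) ) / √( p₁ p₂ ⋯ p_{N−1} (1 − ∑_{i=1}^{N−1} p_i) ) dp, where Δ = { p ∈ ℝ^{N−1} : p_i > 0 for all i and ∑_{i=1}^{N−1} p_i < 1 }, H(p) = −∑_{i=1}^{N−1} p_i ln p_i − (1 − ∑_{i=1}^{N−1} p_i) ln(1 − ∑_{i=1}^{N−1} p_i), and the integral is with respect to (N−1)-dimensional Lebesgue measure. Then lim_{n→∞} I_n / N^n = 1. -/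

import Mathlib

open Filter MeasureTheory

lemma sx_negMulLog_le {p u : ℝ} (hp : 0 < p) (hp1 : p ≤ 1) (hu : 0 < u) (hu1 : u ≤ 1) :
    Real.negMulLog p ≤ Real.negMulLog u - (Real.log u + 1) * (p - u) - (p - u) ^ 2 / 4 := by
  obtain ⟨a, ha, rfl⟩ : ∃ a, 0 < a ∧ a ^ 2 = p := ⟨√p, by positivity, Real.sq_sqrt hp.le⟩
  obtain ⟨b, hb, rfl⟩ : ∃ b, 0 < b ∧ b ^ 2 = u := ⟨√u, by positivity, Real.sq_sqrt hu.le⟩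
  have ha1 : a ≤ 1 := by nlinarith
  have hb1 : b ≤ 1 := by nlinarith
  have h := Real.log_le_sub_one_of_pos (div_pos hb ha)
  rw [Real.log_div hb.ne' ha.ne'] at h
  have h2 : a ^ 2 * (Real.log b - Real.log a) ≤ a * b - a ^ 2 := by
    calc _ ≤ a ^ 2 * (b / a - 1) := by gcongr
      _ = _ := by field_simp
  simp only [Real.negMulLog, Real.log_pow]
  push_cast
  have h3 : (a ^ 2 - b ^ 2) ^ 2 ≤ 4 * (a - b) ^ 2 := by
    have : (a + b) ^ 2 ≤ 4 := by nlinarith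
    nlinarith [mul_le_mul_of_nonneg_left this (sq_nonneg (a - b))]
  nlinarith

lemma sx_psi {s : ℝ} (hs : |s| ≤ 1 / 2) :
    |(1 + s) * Real.log (1 + s) - s - s ^ 2 / 2| ≤ 4 * |s| ^ 3 := by
  have h := Real.abs_log_sub_add_sum_range_le (x := -s) (by rw [abs_neg]; linarith) 2
  simp only [Finset.sum_range_succ, Finset.sum_range_zero, abs_neg] at h
  norm_num at h
  have h1 : |s| ^ 3 / (1 - |s|) ≤ 2 * |s| ^ 3 := by
    rw [div_le_iff₀ (by linarith)]
    have := pow_nonneg (abs_nonneg s) 3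
    nlinarith
  set e := -s + s ^ 2 / 2 + Real.log (1 + s) with he
  have hl : Real.log (1 + s) = s - s ^ 2 / 2 + e := by rw [he]; ring
  have h2 : (1 + s) * Real.log (1 + s) - s - s ^ 2 / 2 = -(s ^ 3 / 2) + (1 + s) * e := by
    rw [hl]; ring
  rw [h2]
  have h3 : |1 + s| ≤ 3 / 2 := (abs_add_le _ _).trans (by rw [abs_one]; linarith)
  calc _ ≤ |-(s ^ 3 / 2)| + |(1 + s) * e| := abs_add_le _ _
    _ = |s| ^ 3 / 2 + |1 + s| * |e| := by rw [abs_neg, abs_div, abs_pow, abs_mul]; norm_num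
    _ ≤ |s| ^ 3 / 2 + 3 / 2 * (2 * |s| ^ 3) := by gcongr; linarith
    _ ≤ _ := by have := pow_nonneg (abs_nonneg s) 3; linarith

lemma sx_inv_sqrt (y : ℝ) : Tendsto (fun n : ℕ => (√(n : ℝ))⁻¹ * y) atTop (nhds 0) := by
  have := (Real.tendsto_sqrt_atTop.comp tendsto_natCast_atTop_atTop).inv_tendsto_atTop.mul_const y
  simpa using this

lemma sx_one_dim {u : ℝ} (hu : 0 < u) (y : ℝ) :
    Tendsto (fun n : ℕ => (n : ℝ) * (Real.negMulLog (u + (√(n : ℝ))⁻¹ * y) - Real.negMulLog u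
      + (Real.log u + 1) * ((√(n : ℝ))⁻¹ * y))) atTop (nhds (-(y ^ 2 / (2 * u)))) := by
  have hs : Tendsto (fun n : ℕ => (√(n : ℝ))⁻¹ * (y / u)) atTop (nhds 0) := sx_inv_sqrt _
  rw [tendsto_iff_dist_tendsto_zero]
  have hb : Tendsto (fun n : ℕ => 4 * u * (y / u) ^ 2 * |(√(n : ℝ))⁻¹ * (y / u)|)
      atTop (nhds 0) := by
    simpa using hs.abs.const_mul (4 * u * (y / u) ^ 2)
  refine squeeze_zero' (Eventually.of_forall fun _ => dist_nonneg) ?_ hb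
  have h12 : ∀ᶠ n : ℕ in atTop, |(√(n : ℝ))⁻¹ * (y / u)| < 1 / 2 := by
    have := hs.abs
    rw [abs_zero] at this
    exact this.eventually_lt_const (by norm_num)
  filter_upwards [h12, eventually_gt_atTop 0] with n hn hn0
  have hn0' : (0 : ℝ) < n := by exact_mod_cast hn0
  set s := (√(n : ℝ))⁻¹ * (y / u) with hsd
  have hsq : (n : ℝ) * s ^ 2 = (y / u) ^ 2 := by
    rw [hsd, mul_pow, inv_pow, Real.sq_sqrt hn0'.le]; field_simp
  have hy : (√(n : ℝ))⁻¹ * y = u * s := by rw [hsd]; field_simp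
  have hpos : 0 < 1 + s := by have := (abs_lt.1 hn).1; linarith
  rw [hy, show u + u * s = u * (1 + s) by ring]
  have hpsi := sx_psi hn.le
  set ps := (1 + s) * Real.log (1 + s) - s - s ^ 2 / 2 with hps
  have e1 : (n : ℝ) * (Real.negMulLog (u * (1 + s)) - Real.negMulLog u
      + (Real.log u + 1) * (u * s)) = -(u * (n * s ^ 2) / 2) - u * n * ps := by
    simp only [Real.negMulLog, Real.log_mul hu.ne' hpos.ne', hps]; ring
  rw [e1, hsq, Real.dist_eq]
  have e2 : -(u * (y / u) ^ 2 / 2) - u * n * ps - -(y ^ 2 / (2 * u)) = -(u * n * ps) := by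
    field_simp; ring
  rw [e2, abs_neg, abs_mul, abs_of_pos (by positivity)]
  calc u * n * |ps| ≤ u * n * (4 * |s| ^ 3) := by gcongr
    _ = 4 * u * (n * |s| ^ 2) * |s| := by ring
    _ = _ := by rw [sq_abs, hsq]

lemma sx_gauss (d : ℕ) {b : ℝ} (hb : 0 < b) :
    ∫ y : Fin d → ℝ, Real.exp (-b * (∑ i, y i ^ 2 + (∑ i, y i) ^ 2)) =
      √(Real.pi / b) ^ d / √((d : ℝ) + 1) := by
  obtain rfl | hd := Nat.eq_zero_or_pos d
  · simp
    simp [Measure.real, MeasureTheory.volume_pi]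
  have hd' : (0 : ℝ) < d := by exact_mod_cast hd
  set r := √((d : ℝ) + 1) with hr
  have hr2 : r ^ 2 = d + 1 := Real.sq_sqrt (by positivity)
  have hr0 : 0 < r := by positivity
  set a := (r - 1) / d with ha
  have had : a * d = r - 1 := by rw [ha]; field_simp
  set M : Matrix (Fin d) (Fin d) ℝ :=
    1 + Matrix.replicateCol Unit (fun _ => a) * Matrix.replicateRow Unit (fun _ => (1 : ℝ)) with hM
  have hdet : M.det = r := by
    rw [hM, Matrix.det_one_add_replicateCol_mul_replicateRow]
    simp [dotProduct]; linarith
  have hMv : ∀ y : Fin d → ℝ, ∀ i, Matrix.toLin' M y i = y i + a * ∑ j, y j := by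
    intro y i
    simp [hM, ← Matrix.mulVec_mulVec, Matrix.mulVec, dotProduct]
  have hq : ∀ y : Fin d → ℝ, ∑ i, (Matrix.toLin' M y i) ^ 2 = ∑ i, y i ^ 2 + (∑ i, y i) ^ 2 := by
    intro y
    simp only [hMv]
    have : ∀ i, (y i + a * ∑ j, y j) ^ 2 = y i ^ 2 + 2 * a * (∑ j, y j) * y i +
      (a * ∑ j, y j) ^ 2 := fun i => by ring
    simp only [this, Finset.sum_add_distrib, ← Finset.mul_sum, Finset.sum_const, Finset.card_univ,
      Fintype.card_fin, nsmul_eq_mul]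
    have h1 : 2 * a + d * a ^ 2 = 1 := by
      have : d * (2 * a + d * a ^ 2) = d * 1 := by nlinarith
      exact mul_left_cancel₀ hd'.ne' this
    linear_combination (∑ i, y i) ^ 2 * h1
  have hmap := Real.map_matrix_volume_pi_eq_smul_volume_pi (M := M) (by rw [hdet]; exact hr0.ne')
  have hcont : Continuous (Matrix.toLin' M) := LinearMap.continuous_of_finiteDimensional _
  have key : ∫ y : Fin d → ℝ, Real.exp (-b * ∑ i, (Matrix.toLin' M y i) ^ 2) =
      r⁻¹ * ∫ z : Fin d → ℝ, Real.exp (-b * ∑ i, z i ^ 2) := by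
    have h1 := integral_map (μ := volume) (φ := Matrix.toLin' M) hcont.aemeasurable
      (f := fun z : Fin d → ℝ => Real.exp (-b * ∑ i, z i ^ 2))
      (Continuous.aestronglyMeasurable (by fun_prop))
    rw [← h1, hmap, hdet, integral_smul_measure, ENNReal.toReal_ofReal (abs_nonneg _),
      abs_of_pos (by positivity), smul_eq_mul]
  simp only [← hq]
  rw [key]
  have h2 : ∀ z : Fin d → ℝ, Real.exp (-b * ∑ i, z i ^ 2) = ∏ i, Real.exp (-b * z i ^ 2) := by
    intro z; rw [Finset.mul_sum, Real.exp_sum]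
  simp only [h2]
  rw [integral_fintype_prod_volume_eq_pow (fun x : ℝ => Real.exp (-b * x ^ 2)), integral_gaussian,
    Fintype.card_fin]
  field_simp

/-- The open simplex in its first `d` coordinates. -/
def sxD (d : ℕ) : Set (Fin d → ℝ) := {p | (∀ i, 0 < p i) ∧ ∑ i, p i < 1}

/-- The product of all `d + 1` coordinates. -/
def sxW (d : ℕ) (p : Fin d → ℝ) : ℝ := (∏ i, p i) * (1 - ∑ i, p i)

lemma sxD_meas (d : ℕ) : MeasurableSet (sxD d) := by
  have : sxD d = (⋂ i, {p : Fin d → ℝ | 0 < p i}) ∩ {p : Fin d → ℝ | ∑ i, p i < 1} := by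
    ext; simp [sxD]
  rw [this]
  exact (MeasurableSet.iInter fun i => measurableSet_lt measurable_const (by fun_prop)).inter
    (measurableSet_lt (by fun_prop) measurable_const)

lemma sxW_cont (d : ℕ) : Continuous (sxW d) := by unfold sxW; fun_prop

lemma sxW_pos {d : ℕ} {p : Fin d → ℝ} (hp : p ∈ sxD d) : 0 < sxW d p :=
  mul_pos (Finset.prod_pos fun i _ => hp.1 i) (by linarith [hp.2])

lemma sx_le_one {d : ℕ} {p : Fin d → ℝ} (hp : p ∈ sxD d) (i : Fin d) : p i < 1 :=
  (Finset.single_le_sum (f := p) (fun j _ => (hp.1 j).le) (Finset.mem_univ i)).trans_lt hp.2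

lemma sxK_meas (d : ℕ) : Measurable (fun p : Fin d → ℝ => 1 / √(sxW d p)) := by
  have := (sxW_cont d).measurable
  fun_prop

lemma sx_int0 (d : ℕ) {c : ℝ} (hc : 0 < c) :
    IntegrableOn (fun p : Fin d → ℝ => 1 / √(sxW d p)) (sxD d ∩ {p | c ≤ 1 - ∑ i, p i}) := by
  have h1 : Integrable ((Set.Ioo (0 : ℝ) 1).indicator (fun t => t ^ (-(1 / 2) : ℝ))) := by
    rw [integrable_indicator_iff measurableSet_Ioo]
    have := intervalIntegral.intervalIntegrable_rpow' (a := 0) (b := 1) (r := -(1 / 2))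
      (by norm_num)
    rw [intervalIntegrable_iff_integrableOn_Ioo_of_le zero_le_one] at this
    exact this
  have h2 := Integrable.fintype_prod (ι := Fin d) (μ := fun _ => (volume : Measure ℝ))
    (f := fun _ => (Set.Ioo (0 : ℝ) 1).indicator (fun t => t ^ (-(1 / 2) : ℝ))) (fun _ => h1)
  have hmeas : MeasurableSet (sxD d ∩ {p : Fin d → ℝ | c ≤ 1 - ∑ i, p i}) :=
    (sxD_meas d).inter (measurableSet_le measurable_const (by fun_prop))
  refine Integrable.mono' (g := fun p => (1 / √c) * ∏ i,
    (Set.Ioo (0 : ℝ) 1).indicator (fun t => t ^ (-(1 / 2) : ℝ)) (p i))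
    ((h2.const_mul (1 / √c)).integrableOn) (sxK_meas d).aestronglyMeasurable ?_
  refine (ae_restrict_iff' hmeas).2 (Eventually.of_forall fun p hp => ?_)
  have hpD := hp.1
  have hpc : c ≤ 1 - ∑ i, p i := hp.2
  rw [Real.norm_of_nonneg (by positivity)]
  have h3 : ∏ i, (Set.Ioo (0 : ℝ) 1).indicator (fun t => t ^ (-(1 / 2) : ℝ)) (p i) =
      1 / √(∏ i, p i) := by
    rw [Real.sqrt_eq_rpow, ← Real.finsetProd_rpow _ _ (fun i _ => (hpD.1 i).le),
      one_div (∏ i, _), ← Finset.prod_inv_distrib]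
    refine Finset.prod_congr rfl fun i _ => ?_
    rw [Set.indicator_of_mem (Set.mem_Ioo.2 ⟨hpD.1 i, sx_le_one hpD i⟩), Real.rpow_neg (hpD.1 i).le]
  rw [h3, sxW, Real.sqrt_mul (Finset.prod_nonneg fun i _ => (hpD.1 i).le), mul_comm,
    one_div_mul_one_div]
  have : 0 < √(∏ i, p i) := Real.sqrt_pos.2 (Finset.prod_pos fun i _ => hpD.1 i)
  have : 0 < √c := Real.sqrt_pos.2 hc
  gcongr

/-- The linear part of the coordinate swap. -/
def sxL (d : ℕ) (j : Fin d) : (Fin d → ℝ) →ₗ[ℝ] (Fin d → ℝ) where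
  toFun p := p - Pi.single j (p j + ∑ i, p i)
  map_add' p q := by
    ext i
    by_cases h : i = j
    · subst h; simp [Finset.sum_add_distrib]; ring
    · simp [h]
  map_smul' c p := by
    ext i
    by_cases h : i = j
    · subst h; simp [← Finset.mul_sum]
    · simp [h]

lemma sxL_sum (d : ℕ) (j : Fin d) (p : Fin d → ℝ) : ∑ i, sxL d j p i = -p j := by
  simp [sxL, Finset.sum_sub_distrib]

lemma sxL_invol (d : ℕ) (j : Fin d) : sxL d j ∘ₗ sxL d j = LinearMap.id := by
  refine LinearMap.ext fun p => ?_
  have hs := sxL_sum d j p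
  have hj : sxL d j p j = -∑ i, p i := by simp [sxL]
  ext i
  have h1 : ∀ q : Fin d → ℝ, sxL d j q = q - Pi.single j (q j + ∑ i, q i) := fun q => rfl
  rw [LinearMap.comp_apply, h1 (sxL d j p), hs, hj, h1 p]
  simp only [LinearMap.id_apply, Pi.sub_apply]
  by_cases h : i = j
  · subst h; simp
  · simp [h]

lemma sx_swap (d : ℕ) (j : Fin d) :
    MeasurePreserving (fun p : Fin d → ℝ => sxL d j p + Pi.single j 1) volume volume := by
  have hdet : LinearMap.det (sxL d j) * LinearMap.det (sxL d j) = 1 := by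
    rw [← LinearMap.det_comp, sxL_invol, LinearMap.det_id]
  have hne : LinearMap.det (sxL d j) ≠ 0 := by intro h; simp [h] at hdet
  have hcont : Continuous (sxL d j) := LinearMap.continuous_of_finiteDimensional _
  have h1 : MeasurePreserving (sxL d j) volume volume := by
    refine ⟨hcont.measurable, ?_⟩
    rw [Measure.map_linearMap_addHaar_eq_smul_addHaar _ hne]
    have : |(LinearMap.det (sxL d j))⁻¹| = 1 := by
      rcases mul_self_eq_one_iff.1 hdet with h | h <;> simp [h]
    simp [this]
  exact (measurePreserving_add_right volume (Pi.single j (1 : ℝ))).comp h1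

lemma sx_int (d : ℕ) : IntegrableOn (fun p : Fin d → ℝ => 1 / √(sxW d p)) (sxD d) := by
  set c : ℝ := 1 / (d + 1) with hc
  have hc0 : 0 < c := by positivity
  have hj : ∀ j : Fin d, IntegrableOn (fun p : Fin d → ℝ => 1 / √(sxW d p))
      (sxD d ∩ {p | c ≤ p j}) := by
    intro j
    have hm0 : MeasurableSet (sxD d ∩ {p : Fin d → ℝ | c ≤ 1 - ∑ i, p i}) :=
      (sxD_meas d).inter (measurableSet_le measurable_const (by fun_prop))
    have hmj : MeasurableSet (sxD d ∩ {p : Fin d → ℝ | c ≤ p j}) :=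
      (sxD_meas d).inter (measurableSet_le measurable_const (by fun_prop))
    have h0 := (integrable_indicator_iff hm0).2 (sx_int0 d hc0)
    have h1 := (sx_swap d j).integrable_comp_of_integrable h0
    rw [← integrable_indicator_iff hmj]
    refine h1.congr (Eventually.of_forall fun p => ?_)
    simp only [Function.comp]
    symm
    set q := sxL d j p + Pi.single j 1 with hq
    have hqj : q j = 1 - ∑ i, p i := by simp [hq, sxL]; ring
    have hqi : ∀ i, i ≠ j → q i = p i := fun i hi => by simp [hq, sxL, hi]
    have hqs : 1 - ∑ i, q i = p j := by
      simp [hq, Finset.sum_add_distrib, sxL_sum]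
    have hW : sxW d q = sxW d p := by
      have e1 := Finset.mul_prod_erase Finset.univ q (Finset.mem_univ j)
      have e2 := Finset.mul_prod_erase Finset.univ p (Finset.mem_univ j)
      have e3 : ∏ i ∈ Finset.univ.erase j, q i = ∏ i ∈ Finset.univ.erase j, p i :=
        Finset.prod_congr rfl fun i hi => hqi i (Finset.ne_of_mem_erase hi)
      rw [sxW, sxW, hqs, ← e1, ← e2, e3, hqj]; ring
    have hmem : (p ∈ sxD d ∩ {p : Fin d → ℝ | c ≤ p j}) ↔
        q ∈ sxD d ∩ {p : Fin d → ℝ | c ≤ 1 - ∑ i, p i} := by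
      simp only [Set.mem_inter_iff, Set.mem_ofPred_eq, hqs, sxD]
      refine and_congr_left fun hcp => ⟨fun h => ⟨fun i => ?_, ?_⟩, fun h => ⟨fun i => ?_, ?_⟩⟩
      · by_cases hi : i = j
        · subst hi; rw [hqj]; linarith [h.2]
        · rw [hqi i hi]; exact h.1 i
      · linarith [h.1 j]
      · by_cases hi : i = j
        · subst hi; linarith
        · rw [← hqi i hi]; exact h.1 i
      · linarith [h.1 j]
    by_cases h : p ∈ sxD d ∩ {p : Fin d → ℝ | c ≤ p j}
    · rw [Set.indicator_of_mem h, Set.indicator_of_mem (hmem.1 h), hW]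
    · rw [Set.indicator_of_notMem h, Set.indicator_of_notMem (fun h' => h (hmem.2 h'))]
  have hU := (integrableOn_finite_iUnion.2 hj).union (sx_int0 d hc0)
  refine hU.mono_set fun p hp => ?_
  by_contra hcon
  simp only [Set.mem_union, Set.mem_iUnion, Set.mem_inter_iff, hp, true_and, Set.mem_ofPred_eq,
    not_or, not_exists, not_le] at hcon
  have : ∑ i, p i ≤ ∑ i : Fin d, c := Finset.sum_le_sum fun i _ => (hcon.1 i).le
  simp at this
  have h2 : (d : ℝ) * c + c = 1 := by rw [hc]; field_simp
  linarith [hcon.2]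

/-- The entropy. -/
noncomputable def sxE (d : ℕ) (p : Fin d → ℝ) : ℝ :=
  ∑ i, Real.negMulLog (p i) + Real.negMulLog (1 - ∑ i, p i)

/-- The normalized integrand. -/
noncomputable def sxG (d : ℕ) (n : ℕ) (p : Fin d → ℝ) : ℝ :=
  Real.exp (n * (sxE d p - Real.log (d + 1))) / √(sxW d p)

/-- The inner region, where all coordinates are at least `1 / (2 (d + 1))`. -/
def sxA (d : ℕ) : Set (Fin d → ℝ) :=
  {p | (∀ i, 1 / ((d : ℝ) + 1) / 2 ≤ p i) ∧ 1 / ((d : ℝ) + 1) / 2 ≤ 1 - ∑ i, p i}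

lemma sxA_meas (d : ℕ) : MeasurableSet (sxA d) := by
  have : sxA d = (⋂ i, {p : Fin d → ℝ | 1 / ((d : ℝ) + 1) / 2 ≤ p i}) ∩
      {p : Fin d → ℝ | 1 / ((d : ℝ) + 1) / 2 ≤ 1 - ∑ i, p i} := by
    ext; simp [sxA]
  rw [this]
  exact (MeasurableSet.iInter fun i => measurableSet_le measurable_const (by fun_prop)).inter
    (measurableSet_le measurable_const (by fun_prop))

lemma sxA_sub (d : ℕ) : sxA d ⊆ sxD d := by
  intro p hp
  have h : 0 < 1 / ((d : ℝ) + 1) / 2 := by positivity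
  exact ⟨fun i => h.trans_le (hp.1 i), by linarith [hp.2]⟩

lemma sxG_meas (d n : ℕ) : Measurable (sxG d n) := by
  have h1 := (sxW_cont d).measurable
  have h2 : Continuous (sxE d) := by unfold sxE; fun_prop
  have h3 := h2.measurable
  unfold sxG
  fun_prop

lemma sxG_nonneg (d n : ℕ) (p : Fin d → ℝ) : 0 ≤ sxG d n p := by unfold sxG; positivity

lemma sx_log (d : ℕ) :
    Real.log ((d : ℝ) + 1) = ((d : ℝ) + 1) * Real.negMulLog (1 / ((d : ℝ) + 1)) := by
  simp only [Real.negMulLog, one_div, Real.log_inv]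
  field_simp

lemma sx_ent_le {d : ℕ} {p : Fin d → ℝ} (hp : p ∈ sxD d) :
    sxE d p - Real.log (d + 1) ≤ -((∑ i, (p i - 1 / ((d : ℝ) + 1)) ^ 2 +
      (1 - ∑ i, p i - 1 / ((d : ℝ) + 1)) ^ 2) / 4) := by
  rw [sx_log]
  set u := 1 / ((d : ℝ) + 1) with hu
  have hu0 : 0 < u := by positivity
  have hu1 : u ≤ 1 := by
    rw [hu, div_le_one (by positivity)]; linarith [Nat.cast_nonneg (α := ℝ) d]
  have hdu : (d : ℝ) * u + u = 1 := by rw [hu]; field_simp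
  have h1 : ∑ i, Real.negMulLog (p i) ≤ ∑ i, (Real.negMulLog u - (Real.log u + 1) * (p i - u)
      - (p i - u) ^ 2 / 4) := Finset.sum_le_sum fun i _ =>
    sx_negMulLog_le (hp.1 i) (sx_le_one hp i).le hu0 hu1
  have h2 := sx_negMulLog_le (p := 1 - ∑ i, p i) (by linarith [hp.2])
    (by linarith [Finset.sum_nonneg fun i (_ : i ∈ Finset.univ) => (hp.1 i).le]) hu0 hu1
  simp only [Finset.sum_sub_distrib, ← Finset.mul_sum, ← Finset.sum_div, Finset.sum_const,
    Finset.card_univ, Fintype.card_fin, nsmul_eq_mul] at h1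
  have h3 : (Real.log u + 1) * (∑ i, p i - d * u) + (Real.log u + 1) * (1 - ∑ i, p i - u) = 0 := by
    linear_combination (-(Real.log u + 1)) * hdu
  unfold sxE
  linarith

lemma sxG_le {d : ℕ} (n : ℕ) {p : Fin d → ℝ} (hp : p ∈ sxD d) : sxG d n p ≤ 1 / √(sxW d p) := by
  unfold sxG
  gcongr
  rw [Real.exp_le_one_iff]
  refine mul_nonpos_of_nonneg_of_nonpos (by positivity) ((sx_ent_le hp).trans ?_)
  rw [neg_nonpos]
  have := Finset.sum_nonneg fun i (_ : i ∈ Finset.univ) => sq_nonneg (p i - 1 / ((d : ℝ) + 1))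
  positivity

lemma sxG_int (d n : ℕ) : IntegrableOn (sxG d n) (sxD d) := by
  refine Integrable.mono' (sx_int d) (sxG_meas d n).aestronglyMeasurable ?_
  refine (ae_restrict_iff' (sxD_meas d)).2 (Eventually.of_forall fun p hp => ?_)
  rw [Real.norm_of_nonneg (sxG_nonneg d n p)]
  exact sxG_le n hp

lemma sxG_far {d : ℕ} (n : ℕ) {p : Fin d → ℝ} (hp : p ∈ sxD d \ sxA d) :
    sxG d n p ≤ Real.exp (-((1 / ((d : ℝ) + 1)) ^ 2 / 16) * n) * (1 / √(sxW d p)) := by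
  unfold sxG
  rw [mul_one_div]
  refine div_le_div_of_nonneg_right (Real.exp_le_exp.2 ?_) (Real.sqrt_nonneg _)
  rw [mul_comm (-_)]
  refine mul_le_mul_of_nonneg_left ?_ (Nat.cast_nonneg n)
  refine (sx_ent_le hp.1).trans ?_
  set u := 1 / ((d : ℝ) + 1) with hu
  have hu0 : 0 < u := by positivity
  have hA := hp.2
  simp only [sxA, Set.mem_ofPred_eq, not_and_or, not_forall, not_le, ← hu] at hA
  have hs := Finset.sum_nonneg fun i (_ : i ∈ Finset.univ) => sq_nonneg (p i - u)
  rcases hA with ⟨i, hi⟩ | h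
  · have h1 := Finset.single_le_sum (f := fun i => (p i - u) ^ 2)
      (fun i (_ : i ∈ Finset.univ) => sq_nonneg (p i - u)) (Finset.mem_univ i)
    have h2 : (u / 2) ^ 2 ≤ (p i - u) ^ 2 := by nlinarith
    nlinarith [sq_nonneg (1 - ∑ i, p i - u)]
  · have h2 : (u / 2) ^ 2 ≤ (1 - ∑ i, p i - u) ^ 2 := by nlinarith
    nlinarith

lemma sx_far_tendsto (d : ℕ) :
    Tendsto (fun n : ℕ => √(n : ℝ) ^ d * ∫ p in sxD d \ sxA d, sxG d n p) atTop (nhds 0) := by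
  set c := (1 / ((d : ℝ) + 1)) ^ 2 / 16 with hc
  have hc0 : 0 < c := by positivity
  set K := ∫ p in sxD d \ sxA d, 1 / √(sxW d p) with hK
  have h1 := ((tendsto_rpow_mul_exp_neg_mul_atTop_nhds_zero ((d : ℝ) / 2) c hc0).comp
    (tendsto_natCast_atTop_atTop (R := ℝ))).mul_const K
  rw [zero_mul] at h1
  refine squeeze_zero (fun n => ?_) (fun n => ?_) h1
  · exact mul_nonneg (by positivity) (integral_nonneg fun p => sxG_nonneg d n p)
  · have e : √(n : ℝ) ^ d = (n : ℝ) ^ ((d : ℝ) / 2) := by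
      rw [Real.sqrt_eq_rpow, ← Real.rpow_natCast, ← Real.rpow_mul (by positivity)]
      congr 1; ring
    simp only [Function.comp]
    rw [e, mul_assoc]
    gcongr
    rw [hK, ← integral_const_mul]
    have hm := (sxD_meas d).diff (sxA_meas d)
    refine setIntegral_mono_on ((sxG_int d n).mono_set Set.sdiff_subset)
      (((sx_int d).mono_set Set.sdiff_subset).const_mul _) hm fun p hp => sxG_far n hp

lemma sx_subst (d n : ℕ) (u : ℝ) :
    ∫ y : Fin d → ℝ, (sxA d).indicator (sxG d n) ((fun _ => u) + (√(n : ℝ))⁻¹ • y) =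
      √(n : ℝ) ^ d * ∫ p in sxA d, sxG d n p := by
  have h1 := Measure.integral_comp_smul (volume : Measure (Fin d → ℝ))
    (fun z => (sxA d).indicator (sxG d n) ((fun _ => u) + z)) (√(n : ℝ))⁻¹
  rw [h1, integral_add_left_eq_self (fun z => (sxA d).indicator (sxG d n) z) (fun _ => u),
    integral_indicator (sxA_meas d), Module.finrank_fintype_fun_eq_card, Fintype.card_fin,
    smul_eq_mul, inv_pow, inv_inv, abs_of_nonneg (by positivity)]

lemma sxW_ge {d : ℕ} {p : Fin d → ℝ} (hp : p ∈ sxA d) :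
    (1 / ((d : ℝ) + 1) / 2) ^ d * (1 / ((d : ℝ) + 1) / 2) ≤ sxW d p := by
  unfold sxW
  have h0 : 0 < 1 / ((d : ℝ) + 1) / 2 := by positivity
  refine mul_le_mul ?_ hp.2 h0.le (Finset.prod_nonneg fun i _ => h0.le.trans (hp.1 i))
  have := Finset.prod_le_prod (s := Finset.univ) (f := fun _ : Fin d => 1 / ((d : ℝ) + 1) / 2)
    (g := p) (fun i _ => h0.le) (fun i _ => hp.1 i)
  rwa [Finset.prod_const, Finset.card_univ, Fintype.card_fin] at this

lemma sx_near_tendsto (d : ℕ) :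
    Tendsto (fun n : ℕ => √(n : ℝ) ^ d * ∫ p in sxA d, sxG d n p) atTop
      (nhds (∫ y : Fin d → ℝ, Real.exp (-(((d : ℝ) + 1) / 2) * (∑ i, y i ^ 2 + (∑ i, y i) ^ 2)) /
        √((1 / ((d : ℝ) + 1)) ^ d * (1 / ((d : ℝ) + 1))))) := by
  set u := 1 / ((d : ℝ) + 1) with hu
  have hu0 : 0 < u := by positivity
  have hdu : (d : ℝ) * u + u = 1 := by rw [hu]; field_simp
  simp only [← sx_subst d _ u]
  set κ := 1 / √((u / 2) ^ d * (u / 2)) with hκ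
  refine tendsto_integral_filter_of_dominated_convergence
    (fun y => κ * ∏ i, Real.exp (-(1 / 4) * y i ^ 2)) ?_ ?_ ?_ ?_
  · refine Eventually.of_forall fun n => Measurable.aestronglyMeasurable ?_
    have h := (sxG_meas d n).indicator (sxA_meas d)
    exact h.comp (by fun_prop)
  · filter_upwards [eventually_gt_atTop 0] with n hn
    refine Eventually.of_forall fun y => ?_
    have hn0 : (0 : ℝ) < n := by exact_mod_cast hn
    by_cases hp : (fun _ => u) + (√(n : ℝ))⁻¹ • y ∈ sxA d
    · rw [Set.indicator_of_mem hp, Real.norm_of_nonneg (sxG_nonneg _ _ _), sxG, hκ,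
        mul_comm (1 / _), mul_one_div]
      have hW := sxW_ge hp
      have hE := sx_ent_le (sxA_sub d hp)
      rw [← hu] at hW hE
      refine div_le_div₀ (Finset.prod_nonneg fun i _ => (Real.exp_pos _).le) ?_ (by positivity)
        (Real.sqrt_le_sqrt hW)
      rw [← Real.exp_sum, Real.exp_le_exp, ← Finset.mul_sum]
      have e1 : ∑ i, (((fun _ : Fin d => u) + (√(n : ℝ))⁻¹ • y) i - u) ^ 2 = (∑ i, y i ^ 2) / n := by
        simp [mul_pow, inv_pow, Real.sq_sqrt hn0.le, ← Finset.mul_sum]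
        field_simp
      rw [e1] at hE
      have h2 := sq_nonneg (1 - ∑ i, ((fun _ : Fin d => u) + (√(n : ℝ))⁻¹ • y) i - u)
      calc _ ≤ (n : ℝ) * (-((∑ i, y i ^ 2) / n / 4)) := by
            gcongr; linarith
        _ = _ := by field_simp
    · rw [Set.indicator_of_notMem hp, norm_zero]
      have : 0 ≤ ∏ i, Real.exp (-(1 / 4) * y i ^ 2) :=
        Finset.prod_nonneg fun i _ => (Real.exp_pos _).le
      positivity
  · have h1 := integrable_exp_neg_mul_sq (b := 1 / 4) (by norm_num)
    exact (Integrable.fintype_prod (ι := Fin d) (μ := fun _ => (volume : Measure ℝ))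
      (f := fun _ t => Real.exp (-(1 / 4) * t ^ 2)) (fun _ => h1)).const_mul κ
  · refine Eventually.of_forall fun y => ?_
    have hlim : Tendsto (fun n : ℕ => (fun _ => u) + (√(n : ℝ))⁻¹ • y) atTop
        (nhds (fun _ : Fin d => u)) := by
      rw [tendsto_pi_nhds]
      intro i
      simpa using (sx_inv_sqrt (y i)).const_add u
    have hsum : ∀ s : ℝ, 1 - ∑ i, ((fun _ : Fin d => u) + s • y) i = u + s * (-∑ i, y i) := by
      intro s
      simp [Finset.sum_add_distrib, ← Finset.mul_sum]
      linarith
    have hA : ∀ᶠ n : ℕ in atTop, (fun _ => u) + (√(n : ℝ))⁻¹ • y ∈ sxA d := by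
      have hO : IsOpen {p : Fin d → ℝ | (∀ i, u / 2 < p i) ∧ u / 2 < 1 - ∑ i, p i} := by
        have : {p : Fin d → ℝ | (∀ i, u / 2 < p i) ∧ u / 2 < 1 - ∑ i, p i} =
          (⋂ i, {p : Fin d → ℝ | u / 2 < p i}) ∩ {p | u / 2 < 1 - ∑ i, p i} := by ext; simp
        rw [this]
        exact (isOpen_iInter_of_finite fun i => isOpen_lt (by fun_prop) (by fun_prop)).inter
          (isOpen_lt (by fun_prop) (by fun_prop))
      have hmem : (fun _ : Fin d => u) ∈
          {p : Fin d → ℝ | (∀ i, u / 2 < p i) ∧ u / 2 < 1 - ∑ i, p i} := by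
        refine ⟨fun i => by linarith, ?_⟩
        simp; linarith
      filter_upwards [hlim.eventually_mem (hO.mem_nhds hmem)] with n hn
      exact ⟨fun i => (hn.1 i).le, hn.2.le⟩
    have hE : Tendsto (fun n : ℕ => (n : ℝ) * (sxE d ((fun _ => u) + (√(n : ℝ))⁻¹ • y) -
        Real.log (d + 1))) atTop
        (nhds (-(((d : ℝ) + 1) / 2) * (∑ i, y i ^ 2 + (∑ i, y i) ^ 2))) := by
      have h1 := (tendsto_finsetSum Finset.univ fun i (_ : i ∈ Finset.univ) =>
        sx_one_dim hu0 (y i)).add (sx_one_dim hu0 (-∑ i, y i))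
      convert h1 using 1
      · ext n
        rw [sxE, hsum, sx_log, ← hu, ← Finset.mul_sum]
        simp only [Finset.sum_add_distrib, Finset.sum_sub_distrib, ← Finset.mul_sum,
          Finset.sum_const, Finset.card_univ, Fintype.card_fin, nsmul_eq_mul, Pi.add_apply,
          Pi.smul_apply, smul_eq_mul]
        ring
      · congr 1
        rw [Finset.sum_neg_distrib, ← Finset.sum_div, hu]
        field_simp
        ring
    have hWl : Tendsto (fun n : ℕ => √(sxW d ((fun _ => u) + (√(n : ℝ))⁻¹ • y))) atTop
        (nhds √(u ^ d * u)) := by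
      have e : sxW d (fun _ => u) = u ^ d * u := by
        simp [sxW]; left; linarith
      rw [← e]
      exact ((Real.continuous_sqrt.comp (sxW_cont d)).tendsto _).comp hlim
    have hT := ((Real.continuous_exp.tendsto _).comp hE).div hWl (by positivity)
    refine hT.congr' ?_
    filter_upwards [hA] with n hn
    rw [Set.indicator_of_mem hn]
    rfl

lemma sx_const (d : ℕ) : ∫ y : Fin d → ℝ,
    Real.exp (-(((d : ℝ) + 1) / 2) * (∑ i, y i ^ 2 + (∑ i, y i) ^ 2)) /
        √((1 / ((d : ℝ) + 1)) ^ d * (1 / ((d : ℝ) + 1))) = √(2 * Real.pi) ^ d := by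
  rw [integral_div, sx_gauss d (by positivity)]
  have e1 : Real.pi / (((d : ℝ) + 1) / 2) = 2 * Real.pi / (d + 1) := by field_simp
  have e2 : √((1 / ((d : ℝ) + 1)) ^ d * (1 / ((d : ℝ) + 1))) =
      (1 / √((d : ℝ) + 1)) ^ d * (1 / √((d : ℝ) + 1)) := by
    rw [Real.sqrt_mul (by positivity), Real.sqrt_div (by positivity), Real.sqrt_one]
    congr 1
    rw [Real.sqrt_eq_iff_mul_self_eq (by positivity) (by positivity), ← mul_pow]
    congr 1
    rw [div_mul_div_comm, Real.mul_self_sqrt (by positivity), one_mul]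
  rw [e1, e2, Real.sqrt_div (by positivity), div_pow, div_pow, one_pow]
  have : 0 < √((d : ℝ) + 1) := by positivity
  field_simp

lemma sx_main (d : ℕ) :
    Tendsto (fun n : ℕ => √(n : ℝ) ^ d * ∫ p in sxD d, sxG d n p) atTop
      (nhds (√(2 * Real.pi) ^ d)) := by
  have h := (sx_near_tendsto d).add (sx_far_tendsto d)
  rw [sx_const, add_zero] at h
  refine h.congr fun n => ?_
  rw [← mul_add]
  congr 1
  rw [← setIntegral_union Set.disjoint_sdiff_right ((sxD_meas d).diff (sxA_meas d))
    ((sxG_int d n).mono_set (sxA_sub d)) ((sxG_int d n).mono_set Set.sdiff_subset),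
    Set.union_sdiff_cancel (sxA_sub d)]

theorem simplex_integral_asymptotics (N : ℕ) (hN : 2 ≤ N) :
    Filter.Tendsto
      (fun n : ℕ =>
        (((n : ℝ) / (2 * Real.pi)) ^ (((N : ℝ) - 1) / 2) *
          ∫ p in {p : Fin (N - 1) → ℝ | (∀ i, 0 < p i) ∧ ∑ i, p i < 1},
            Real.exp ((n : ℝ) *
                (-(∑ i, p i * Real.log (p i)) -
                  (1 - ∑ i, p i) * Real.log (1 - ∑ i, p i))) /
              Real.sqrt ((∏ i, p i) * (1 - ∑ i, p i))) /
          (N : ℝ) ^ n)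
      Filter.atTop (nhds 1) := by
  obtain ⟨d, rfl⟩ : ∃ d, N = d + 1 := ⟨N - 1, by omega⟩
  change Tendsto (fun n : ℕ => (((n : ℝ) / (2 * Real.pi)) ^ ((((d + 1 : ℕ) : ℝ) - 1) / 2) *
          ∫ p in {p : Fin d → ℝ | (∀ i, 0 < p i) ∧ ∑ i, p i < 1},
            Real.exp ((n : ℝ) *
                (-(∑ i, p i * Real.log (p i)) -
                  (1 - ∑ i, p i) * Real.log (1 - ∑ i, p i))) /
              Real.sqrt ((∏ i, p i) * (1 - ∑ i, p i))) /
          ((d + 1 : ℕ) : ℝ) ^ n) atTop (nhds 1)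
  have hpi : 0 < √(2 * Real.pi) ^ d := by positivity
  have h := (sx_main d).div_const (√(2 * Real.pi) ^ d)
  rw [div_self hpi.ne'] at h
  refine h.congr fun n => ?_
  have e1 : ((n : ℝ) / (2 * Real.pi)) ^ ((((d + 1 : ℕ) : ℝ) - 1) / 2) =
      √(n : ℝ) ^ d / √(2 * Real.pi) ^ d := by
    rw [← div_pow, ← Real.sqrt_div (by positivity), Real.sqrt_eq_rpow, ← Real.rpow_natCast,
      ← Real.rpow_mul (by positivity)]
    congr 1; push_cast; ring
  have e2 : ∀ p : Fin d → ℝ, sxG d n p = (Real.exp ((n : ℝ) *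
                (-(∑ i, p i * Real.log (p i)) -
                  (1 - ∑ i, p i) * Real.log (1 - ∑ i, p i))) /
              Real.sqrt ((∏ i, p i) * (1 - ∑ i, p i))) / ((d + 1 : ℕ) : ℝ) ^ n := by
    intro p
    have e3 : ((d + 1 : ℕ) : ℝ) ^ n = Real.exp (n * Real.log ((d : ℝ) + 1)) := by
      rw [Real.exp_nat_mul, Real.exp_log (by positivity)]; push_cast; rfl
    have e4 : sxE d p = -(∑ i, p i * Real.log (p i)) -
                  (1 - ∑ i, p i) * Real.log (1 - ∑ i, p i) := by
      simp only [sxE, Real.negMulLog, neg_mul, Finset.sum_neg_distrib]; ring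
    rw [e3, sxG, e4, mul_sub, Real.exp_sub, sxW, div_right_comm]
  simp only [e2, integral_div, e1, sxD]
  ring
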